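/- For every a ∈ ℕ, the family (μ_a(d))_{d∈ℤ} is a probability distribution on ℤ: μ_a(d) ≥ 0 for all d and ∑_{d∈ℤ} μ_a(d) = 1. Moreover it has mean zero: ∑_{d∈ℤ} d·μ_a(d) = 0. -/

import Mathlib

open Filter

/-- `s₂ n` is the number of 1's in the binary expansion of `n`. -/
def s2 (n : ℕ) : ℕ := (Nat.digits 2 n).sum

/-- The counting sequence whose limit is the asymptotic density
`μ_a(d)` of `{n : s₂(n+a) - s₂(n) = d}`. -/
noncomputable def densSeq (a : ℕ) (d : ℤ) (N : ℕ) : ℝ :=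
  (((Finset.range N).filter fun n => (s2 (n + a) : ℤ) - s2 n = d).card : ℝ) / N

lemma s2_double (n : ℕ) : s2 (2 * n) = s2 n := by
  unfold s2
  rcases Nat.eq_zero_or_pos n with h | h
  · simp [h]
  · rw [Nat.digits_def' (by norm_num) (by omega)]
    simp

lemma s2_double_add (n : ℕ) : s2 (2 * n + 1) = s2 n + 1 := by
  unfold s2
  rw [Nat.digits_def' (by norm_num) (by omega)]
  have h1 : (2 * n + 1) % 2 = 1 := by omega
  have h2 : (2 * n + 1) / 2 = n := by omega
  rw [h1, h2, List.sum_cons, add_comm]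

/-- The difference of digit sums. -/
def dif (a n : ℕ) : ℤ := (s2 (n + a) : ℤ) - s2 n

lemma s2_sq (n : ℕ) : s2 n ≤ n ∧ s2 n ^ 2 ≤ 4 * n := by
  induction n using Nat.strong_induction_on with
  | _ n ih =>
    rcases Nat.eq_zero_or_pos n with h | h
    · subst h; simp [s2]
    · rcases Nat.even_or_odd' n with ⟨m, rfl | rfl⟩
      · have := ih m (by omega)
        rw [s2_double]; omega
      · have := ih m (by omega)
        rw [s2_double_add]
        constructor
        · omega
        · nlinarith [this.1, this.2]

lemma dif_one_even (n : ℕ) : dif 1 (2 * n) = 1 := by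
  simp [dif, s2_double, s2_double_add]

lemma dif_one_odd (n : ℕ) : dif 1 (2 * n + 1) = dif 1 n - 1 := by
  unfold dif
  rw [show 2 * n + 1 + 1 = 2 * (n + 1) by ring, s2_double, s2_double_add]
  push_cast; ring

lemma quartic (x : ℝ) : (x - 1) ^ 4 ≤ 3 / 2 * x ^ 4 + 1000 := by
  have h : (x - 1) ^ 2 ≤ 6 / 5 * x ^ 2 + 6 := by nlinarith [sq_nonneg (x + 5)]
  have h2 : ((x - 1) ^ 2) ^ 2 ≤ (6 / 5 * x ^ 2 + 6) ^ 2 := by gcongr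
  nlinarith [sq_nonneg (x ^ 2 - 120)]

lemma sum_split (f : ℕ → ℝ) (m : ℕ) :
    ∑ n ∈ Finset.range (2 * m), f n = ∑ n ∈ Finset.range m, (f (2 * n) + f (2 * n + 1)) := by
  induction m with
  | zero => simp
  | succ m ih =>
    rw [show 2 * (m + 1) = 2 * m + 1 + 1 by ring, Finset.sum_range_succ, Finset.sum_range_succ, ih,
      Finset.sum_range_succ]
    ring

lemma moment_one (N : ℕ) : ∑ n ∈ Finset.range N, (dif 1 n : ℝ) ^ 4 ≤ 2002 * N := by
  induction N using Nat.strong_induction_on with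
  | _ N ih =>
    have key : ∀ m : ℕ, (∑ n ∈ Finset.range m, (dif 1 n : ℝ) ^ 4 ≤ 2002 * m) →
        ∑ n ∈ Finset.range (2 * m), (dif 1 n : ℝ) ^ 4 ≤ 2002 * (2 * m) := by
      intro m hm
      rw [sum_split]
      calc _ ≤ ∑ n ∈ Finset.range m, (1001 + 3 / 2 * (dif 1 n : ℝ) ^ 4) := by
            apply Finset.sum_le_sum
            intro n _
            rw [dif_one_even, dif_one_odd]
            push_cast
            have := quartic (dif 1 n)
            linarith
        _ ≤ _ := by
            rw [Finset.sum_add_distrib, ← Finset.mul_sum]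
            simp
            linarith
    rcases Nat.eq_zero_or_pos N with h | h
    · subst h; simp
    · rcases Nat.even_or_odd' N with ⟨m, rfl | rfl⟩
      · have := key m (ih m (by omega))
        push_cast; exact this
      · have := key m (ih m (by omega))
        rw [Finset.sum_range_succ, dif_one_even]
        push_cast; linarith

lemma dif_succ (a n : ℕ) : dif (a + 1) n = dif a n + dif 1 (n + a) := by
  unfold dif
  rw [add_assoc]; ring

lemma moment (a : ℕ) : ∃ C : ℝ, 0 ≤ C ∧
    ∀ N : ℕ, ∑ n ∈ Finset.range N, (dif a n : ℝ) ^ 4 ≤ C * N := by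
  induction a with
  | zero => exact ⟨0, le_rfl, fun N => by simp [dif]⟩
  | succ a ih =>
    obtain ⟨C, hC, h⟩ := ih
    refine ⟨8 * (C + 2002 * (1 + a)), by positivity, fun N => ?_⟩
    rcases Nat.eq_zero_or_pos N with h0 | h0
    · subst h0; simp
    have hN : (1 : ℝ) ≤ N := by exact_mod_cast h0
    have h1 : ∑ n ∈ Finset.range N, (dif 1 (n + a) : ℝ) ^ 4 ≤ 2002 * (N + a) := by
      have h2 := moment_one (a + N)
      rw [Finset.sum_range_add] at h2
      have h3 : 0 ≤ ∑ n ∈ Finset.range a, (dif 1 n : ℝ) ^ 4 :=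
        Finset.sum_nonneg fun _ _ => by positivity
      simp only [add_comm a] at h2
      push_cast at h2
      linarith
    calc _ ≤ ∑ n ∈ Finset.range N, (8 * (dif a n : ℝ) ^ 4 + 8 * (dif 1 (n + a) : ℝ) ^ 4) := by
          apply Finset.sum_le_sum
          intro n _
          rw [dif_succ]
          push_cast
          generalize (dif a n : ℝ) = x
          generalize (dif 1 (n + a) : ℝ) = y
          have e1 : (x + y) ^ 2 ≤ 2 * x ^ 2 + 2 * y ^ 2 := by nlinarith [sq_nonneg (x - y)]
          have e2 : ((x + y) ^ 2) ^ 2 ≤ (2 * x ^ 2 + 2 * y ^ 2) ^ 2 := by gcongr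
          nlinarith [sq_nonneg (x ^ 2 - y ^ 2)]
      _ ≤ _ := by
          rw [Finset.sum_add_distrib, ← Finset.mul_sum, ← Finset.mul_sum]
          have := h N
          have ha : (a : ℝ) ≤ a * N := le_mul_of_one_le_right (by positivity) hN
          linarith

lemma hasSum_dens (a N : ℕ) (w : ℤ → ℝ) :
    HasSum (fun d => w d * densSeq a d N) ((∑ n ∈ Finset.range N, w (dif a n)) / N) := by
  have h : ∀ n ∈ Finset.range N,
      HasSum (fun d : ℤ => if d = dif a n then w (dif a n) else 0) (w (dif a n)) :=
    fun n _ => hasSum_ite_eq _ _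
  have h2 := (hasSum_sum h).div_const (N : ℝ)
  refine (funext fun d => ?_ : (fun d => w d * densSeq a d N) = _) ▸ h2
  unfold densSeq
  rw [← mul_div_assoc, Finset.card_filter]
  push_cast
  rw [Finset.mul_sum]
  congr 1
  apply Finset.sum_congr rfl
  intro n _
  change w d * (if dif a n = d then 1 else 0) = _
  by_cases hd : d = dif a n
  · simp [← hd]
  · simp [hd, Ne.symm hd]

lemma densSeq_nonneg (a : ℕ) (d : ℤ) (N : ℕ) : 0 ≤ densSeq a d N := by
  unfold densSeq; positivity

lemma densSeq_le_one (a : ℕ) (d : ℤ) (N : ℕ) : densSeq a d N ≤ 1 := by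
  unfold densSeq
  apply div_le_one_of_le₀ _ (by positivity)
  have := Finset.card_filter_le (Finset.range N) (fun n => (s2 (n + a) : ℤ) - s2 n = d)
  rw [Finset.card_range] at this
  exact_mod_cast this

lemma s2_tendsto (a : ℕ) :
    Tendsto (fun N : ℕ => (dif N a : ℝ) / N) atTop (nhds 0) := by
  have hN : Tendsto (fun N : ℕ => (N : ℝ)) atTop atTop := tendsto_natCast_atTop_atTop
  have hs : Tendsto (fun N : ℕ => Real.sqrt N) atTop atTop := Real.tendsto_sqrt_atTop.comp hN
  have hb : Tendsto (fun N : ℕ => 2 / Real.sqrt N + (2 * Real.sqrt a + s2 a) / (N : ℝ))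
      atTop (nhds 0) := by
    have := (hs.const_div_atTop 2).add (hN.const_div_atTop (2 * Real.sqrt a + s2 a))
    simpa using this
  apply squeeze_zero_norm' _ hb
  filter_upwards [eventually_gt_atTop 0] with N h0
  have h0' : (0 : ℝ) < N := by exact_mod_cast h0
  have e : 2 / Real.sqrt N = 2 * Real.sqrt N / N := by
    rw [div_eq_div_iff (by positivity) (by positivity), mul_assoc, Real.mul_self_sqrt h0'.le]
  rw [e, ← add_div, norm_div, Real.norm_natCast]
  gcongr
  have h1 : (s2 (a + N) : ℝ) ≤ 2 * Real.sqrt N + 2 * Real.sqrt a := by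
    apply le_of_sq_le_sq _ (by positivity)
    have h2 : (s2 (a + N) : ℝ) ^ 2 ≤ 4 * (a + N) := by exact_mod_cast (s2_sq (a + N)).2
    nlinarith [Real.sq_sqrt h0'.le, Real.sq_sqrt (Nat.cast_nonneg (α := ℝ) a),
      mul_nonneg (Real.sqrt_nonneg N) (Real.sqrt_nonneg a)]
  unfold dif
  push_cast
  rw [Real.norm_eq_abs, abs_le]
  have h3 : (0 : ℝ) ≤ s2 (a + N) := by positivity
  have h4 : (0 : ℝ) ≤ s2 a := by positivity
  have h5 := Real.sqrt_nonneg N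
  have h6 := Real.sqrt_nonneg a
  constructor <;> linarith

lemma mean_tendsto (a : ℕ) :
    Tendsto (fun N : ℕ => (∑ n ∈ Finset.range N, (dif a n : ℝ)) / N) atTop (nhds 0) := by
  induction a with
  | zero => simp [dif]
  | succ a ih =>
    have := ih.add (s2_tendsto a)
    rw [add_zero] at this
    refine this.congr fun N => ?_
    rw [← add_div]
    congr 1
    have e : ∀ n, (dif (a + 1) n : ℝ) = dif a n + dif 1 (n + a) := fun n => by
      rw [dif_succ]; push_cast; rfl
    rw [Finset.sum_congr rfl fun n _ => e n, Finset.sum_add_distrib]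
    congr 1
    have := Finset.sum_range_sub (fun n => (s2 (n + a) : ℝ)) N
    unfold dif
    push_cast
    rw [zero_add] at this
    rw [add_comm a N, ← this]
    apply Finset.sum_congr rfl
    intro n _
    rw [add_right_comm]

lemma dens_bound (a : ℕ) : ∃ C : ℝ, 0 ≤ C ∧
    ∀ (d : ℤ) (N : ℕ), (d : ℝ) ^ 4 * densSeq a d N ≤ C := by
  obtain ⟨C, hC, h⟩ := moment a
  refine ⟨C, hC, fun d N => ?_⟩
  have h1 := le_hasSum (hasSum_dens a N (fun d => (d : ℝ) ^ 4)) d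
    (fun j _ => mul_nonneg (by positivity) (densSeq_nonneg a j N))
  refine h1.trans ?_
  exact div_le_of_le_mul₀ (by positivity) hC (h N)

lemma hasSum_limit (f : ℕ → ℤ → ℝ) (g b : ℤ → ℝ) (S : ℕ → ℝ) (s : ℝ) (hb : Summable b)
    (hf : ∀ N, HasSum (f N) (S N)) (hS : Tendsto S atTop (nhds s))
    (hg : ∀ d, Tendsto (fun N => f N d) atTop (nhds (g d)))
    (hbd : ∀ N d, ‖f N d‖ ≤ b d) : HasSum g s := by
  have h1 := tendsto_tsum_of_dominated_convergence hb hg (Eventually.of_forall hbd)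
  have h2 : Summable g := Summable.of_norm_bounded hb
    fun d => le_of_tendsto (hg d).norm (Eventually.of_forall fun N => hbd N d)
  have h3 : ∑' d, g d = s := by
    refine tendsto_nhds_unique h1 (hS.congr fun N => ?_)
    exact (hf N).tsum_eq.symm
  exact h3 ▸ h2.hasSum

theorem mu_probability_mean_zero (μ : ℕ → ℤ → ℝ)
    (hμ : ∀ a d, Tendsto (densSeq a d) atTop (nhds (μ a d))) :
    ∀ a : ℕ,
      (∀ d : ℤ, 0 ≤ μ a d) ∧
      HasSum (fun d : ℤ => μ a d) 1 ∧
      HasSum (fun d : ℤ => (d : ℝ) * μ a d) 0 := by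
  intro a
  obtain ⟨C, hC, h⟩ := dens_bound a
  have hs : Summable (fun d : ℤ => C * |1 / (d : ℝ) ^ 3|) :=
    ((Real.summable_one_div_int_pow (p := 3)).2 (by norm_num)).abs.mul_left C
  have hb2 : ∀ (N : ℕ) (d : ℤ), ‖(d : ℝ) * densSeq a d N‖ ≤ C * |1 / (d : ℝ) ^ 3| := by
    intro N d
    by_cases hd : d = 0
    · simp [hd]
    have hd' : 0 < |(d : ℝ)| := by positivity
    have := h d N
    rw [norm_mul, Real.norm_eq_abs, Real.norm_eq_abs, abs_of_nonneg (densSeq_nonneg a d N),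
      abs_div, abs_one, abs_pow, mul_one_div, le_div_iff₀ (by positivity)]
    calc _ = |(d : ℝ)| ^ 4 * densSeq a d N := by ring
      _ = (d : ℝ) ^ 4 * densSeq a d N := by rw [Even.pow_abs (by decide)]
      _ ≤ C := this
  refine ⟨fun d => ge_of_tendsto' (hμ a d) (densSeq_nonneg a d), ?_, ?_⟩
  · refine hasSum_limit (fun N d => 1 * densSeq a d N) _
      (fun d => C * |1 / (d : ℝ) ^ 3| + if d = 0 then 1 else 0) _ 1
      (hs.add (hasSum_ite_eq 0 1).summable) (fun N => hasSum_dens a N (fun _ => 1)) ?_ ?_ ?_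
    · refine tendsto_const_nhds.congr' ?_
      filter_upwards [eventually_gt_atTop 0] with N hN
      have : (N : ℝ) ≠ 0 := by positivity
      simp [this]
    · intro d; simpa using hμ a d
    · intro N d
      rw [one_mul, Real.norm_eq_abs, abs_of_nonneg (densSeq_nonneg a d N)]
      by_cases hd : d = 0
      · simpa [hd] using densSeq_le_one a 0 N
      · have h1 := hb2 N d
        rw [norm_mul, Real.norm_eq_abs, Real.norm_eq_abs,
          abs_of_nonneg (densSeq_nonneg a d N)] at h1
        have h2 : (1 : ℝ) ≤ |(d : ℝ)| := by exact_mod_cast Int.one_le_abs hd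
        have h3 := le_mul_of_one_le_left (densSeq_nonneg a d N) h2
        simp only [hd, if_false, add_zero]
        linarith
  · exact hasSum_limit (fun N d => (d : ℝ) * densSeq a d N) _ _ _ 0 hs
      (fun N => hasSum_dens a N (fun d => (d : ℝ))) (mean_tendsto a)
      (fun d => (hμ a d).const_mul _) hb2
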